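/- Let H₁ be the 3-dimensional complex Heisenberg Lie algebra with basis {e_1, e_2, e_3} and nonzero brackets [e_2,e_3] = −[e_3,e_2] = e_1. Then up to isomorphism there is exactly one 5-dimensional complex solvable Lie algebra whose nilradical is isomorphic to H₁; it admits a basis {e_1, e_2, e_3, x_1, x_2} with nonzero brackets (up to antisymmetry) exactly [e_2,e_3]=e_1, [e_2,x_1]=e_2, [e_1,x_1]=e_1, [e_3,x_2]=e_3, [e_1,x_2]=e_1. -/

import Mathlib

open Module Submodule

universe u v w

/-- A bilinear bracket on `L`. -/
abbrev Bil (L : Type u) [AddCommGroup L] [Module ℂ L] : Type u := L →ₗ[ℂ] L →ₗ[ℂ] L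

variable {L : Type u} [AddCommGroup L] [Module ℂ L]

/-- The (right) Leibniz identity. -/
def IsLeibniz (br : Bil L) : Prop :=
  ∀ x y z : L, br (br x y) z = br (br x z) y + br x (br y z)

/-- The span of all brackets `[S, T]`. -/
def bspan (br : Bil L) (S T : Submodule ℂ L) : Submodule ℂ L :=
  Submodule.span ℂ {z : L | ∃ x ∈ S, ∃ y ∈ T, z = br x y}

/-- `I` is a (two-sided) ideal of the subalgebra `S`. -/
def IsIdealIn (br : Bil L) (S I : Submodule ℂ L) : Prop :=
  I ≤ S ∧ ∀ x ∈ I, ∀ y ∈ S, br x y ∈ I ∧ br y x ∈ I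

/-- `I` is a (two-sided) ideal of the whole algebra. -/
abbrev IsIdeal (br : Bil L) (I : Submodule ℂ L) : Prop := IsIdealIn br ⊤ I

/-- Lower central series of the subalgebra `S`. -/
def lcs (br : Bil L) (S : Submodule ℂ L) : ℕ → Submodule ℂ L
  | 0 => S
  | n + 1 => bspan br (lcs br S n) S

/-- The subalgebra `S` is nilpotent. -/
def IsNilpotentSub (br : Bil L) (S : Submodule ℂ L) : Prop :=
  ∃ n, lcs br S n = ⊥

/-- Derived series of the subalgebra `S`. -/
def derS (br : Bil L) (S : Submodule ℂ L) : ℕ → Submodule ℂ L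
  | 0 => S
  | n + 1 => bspan br (derS br S n) (derS br S n)

/-- The subalgebra `S` is solvable. -/
def IsSolvableSub (br : Bil L) (S : Submodule ℂ L) : Prop :=
  ∃ m, derS br S m = ⊥

/-- `N` is the nilradical (maximal nilpotent ideal) of the subalgebra `S`. -/
def IsNilradicalIn (br : Bil L) (S N : Submodule ℂ L) : Prop :=
  IsIdealIn br S N ∧ IsNilpotentSub br N ∧
    ∀ I : Submodule ℂ L, IsIdealIn br S I → IsNilpotentSub br I → I ≤ N

/-- `N` is the nilradical of the whole algebra. -/
abbrev IsNilradical (br : Bil L) (N : Submodule ℂ L) : Prop := IsNilradicalIn br ⊤ N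

/-- `N² = [N, N]`. -/
abbrev sqr (br : Bil L) (N : Submodule ℂ L) : Submodule ℂ L := bspan br N N

/-- `dim (N / N²)`. -/
noncomputable def dimModSq (br : Bil L) (N : Submodule ℂ L) : ℕ :=
  finrank ℂ (↥N ⧸ (Submodule.comap N.subtype (sqr br N)))

/-- The subalgebra `S` splits as a direct sum of two nonzero ideals. -/
def IsSplitIn (br : Bil L) (S : Submodule ℂ L) : Prop :=
  ∃ A B : Submodule ℂ L, IsIdealIn br S A ∧ IsIdealIn br S B ∧
    A ≠ ⊥ ∧ B ≠ ⊥ ∧ A ⊓ B = ⊥ ∧ A ⊔ B = S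

/-- The subalgebra `S` is abelian. -/
def IsAbelianIn (br : Bil L) (S : Submodule ℂ L) : Prop :=
  ∀ x ∈ S, ∀ y ∈ S, br x y = 0

section Two
variable {L1 : Type v} {L2 : Type w} [AddCommGroup L1] [Module ℂ L1]
  [AddCommGroup L2] [Module ℂ L2]

/-- A bracket-preserving linear isomorphism between the subalgebra `S1` of `L1` and
the subalgebra `S2` of `L2`. -/
def SubAlgIso (br1 : Bil L1) (S1 : Submodule ℂ L1) (br2 : Bil L2) (S2 : Submodule ℂ L2) :
    Prop :=
  ∃ φ : S1 →ₗ[ℂ] L2, Function.Injective φ ∧ Set.range ⇑φ = (S2 : Set L2) ∧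
    ∀ x y z : S1, (z : L1) = br1 (x : L1) (y : L1) → φ z = br2 (φ x) (φ y)

/-- An isomorphism of the two algebras. -/
def AlgIso (br1 : Bil L1) (br2 : Bil L2) : Prop :=
  ∃ φ : L1 ≃ₗ[ℂ] L2, ∀ x y : L1, φ (br1 x y) = br2 (φ x) (φ y)

end Two

/-- The multiplication table of the unique `5`-dimensional solvable Lie algebra with
nilradical the Heisenberg algebra `H₁`, on the basis `e₁ ↦ v 0`, `e₂ ↦ v 1`, `e₃ ↦ v 2`,
`x₁ ↦ v 3`, `x₂ ↦ v 4`; the nonzero brackets, up to antisymmetry, are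
`[e₂,e₃] = e₁`, `[e₂,x₁] = e₂`, `[e₁,x₁] = e₁`, `[e₃,x₂] = e₃`, `[e₁,x₂] = e₁`. -/
def table19 {W : Type v} [AddCommGroup W] [Module ℂ W]
    (v : Fin 5 → W) (i j : Fin 5) : W :=
  if i = 1 ∧ j = 2 then v 0
  else if i = 2 ∧ j = 1 then -v 0
  else if i = 1 ∧ j = 3 then v 1
  else if i = 3 ∧ j = 1 then -v 1
  else if i = 0 ∧ j = 3 then v 0
  else if i = 3 ∧ j = 0 then -v 0
  else if i = 2 ∧ j = 4 then v 2
  else if i = 4 ∧ j = 2 then -v 2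
  else if i = 0 ∧ j = 4 then v 0
  else if i = 4 ∧ j = 0 then -v 0
  else 0


/-- Matrix of the right multiplication by `y` on `N / Z`. -/
def Rep19 (br : Bil L) (e1 e2 e3 y : L) (a b c d : ℂ) : Prop :=
  ∃ s t : ℂ, br e2 y = a • e2 + b • e3 + s • e1 ∧ br e3 y = c • e2 + d • e3 + t • e1

/-- Heisenberg relations. -/
structure Heis19 (br : Bil L) (e1 e2 e3 : L) : Prop where
  leib : IsLeibniz br
  anti : ∀ x y : L, br x y = - br y x
  h23 : br e2 e3 = e1
  h12 : br e1 e2 = 0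
  h13 : br e1 e3 = 0
  ne : e1 ≠ 0

theorem anti_self19 {br : Bil L} (anti : ∀ x y : L, br x y = - br y x) (x : L) :
    br x x = 0 := by
  have h := anti x x
  have h2 : (2 : ℂ) • br x x = 0 := by
    rw [two_smul]
    nth_rewrite 1 [h]
    simp
  simpa using h2

theorem Heis19.h32 {br : Bil L} {e1 e2 e3 : L} (H : Heis19 br e1 e2 e3) : br e3 e2 = -e1 := by
  rw [H.anti, H.h23]
theorem Heis19.h21 {br : Bil L} {e1 e2 e3 : L} (H : Heis19 br e1 e2 e3) : br e2 e1 = 0 := by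
  rw [H.anti, H.h12, neg_zero]
theorem Heis19.h31 {br : Bil L} {e1 e2 e3 : L} (H : Heis19 br e1 e2 e3) : br e3 e1 = 0 := by
  rw [H.anti, H.h13, neg_zero]

theorem Heis19.coef {br : Bil L} {e1 e2 e3 : L} (H : Heis19 br e1 e2 e3) {b c a : ℂ}
    (h : b • e2 + c • e3 + a • e1 = 0) : b = 0 ∧ c = 0 ∧ a = 0 := by
  have k3 := congrArg (fun z => br z e3) h
  have k2 := congrArg (fun z => br z e2) h
  simp [H.h23, H.h13, H.h12, H.h32, anti_self19 H.anti, H.ne] at k2 k3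
  subst k2 k3
  simp [H.ne] at h
  simp [h]

theorem Heis19.one {br : Bil L} {e1 e2 e3 : L} (H : Heis19 br e1 e2 e3) {y : L} {a b c d : ℂ}
    (h : Rep19 br e1 e2 e3 y a b c d) : br e1 y = (a + d) • e1 := by
  obtain ⟨s, t, h2, h3⟩ := h
  have := H.leib e2 e3 y
  rw [H.h23, h2, h3] at this
  rw [this]
  simp [H.h23, H.h13, H.h12, H.h32, H.h21, H.h31, anti_self19 H.anti]
  module

theorem Rep19.lin {br : Bil L} {e1 e2 e3 : L} {y y' : L} {a b c d a' b' c' d' : ℂ}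
    (h : Rep19 br e1 e2 e3 y a b c d) (h' : Rep19 br e1 e2 e3 y' a' b' c' d') (p q : ℂ) :
    Rep19 br e1 e2 e3 (p • y + q • y') (p * a + q * a') (p * b + q * b') (p * c + q * c')
      (p * d + q * d') := by
  obtain ⟨s, t, h2, h3⟩ := h
  obtain ⟨s', t', h2', h3'⟩ := h'
  refine ⟨p * s + q * s', p * t + q * t', ?_, ?_⟩
  · simp only [map_add, map_smul, h2, h2']; module
  · simp only [map_add, map_smul, h3, h3']; module

theorem Heis19.nil {br : Bil L} {e1 e2 e3 : L} (H : Heis19 br e1 e2 e3) {N : Submodule ℂ L}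
    (hN : IsNilradical br N) (hmem : ∀ z, z ∈ N ↔ ∃ b c a : ℂ, z = b • e2 + c • e3 + a • e1)
    {y : L} {a b c d : ℂ} (h : Rep19 br e1 e2 e3 y a b c d) (htr : a + d = 0)
    (hdet : a * d - b * c = 0)
    (hid : ∀ z, ∃ r : ℂ, ∃ n ∈ N, br y z = n + r • y) : y ∈ N := by
  have hone := H.one h
  rw [htr, zero_smul] at hone
  obtain ⟨s, t, h2, h3⟩ := h
  have hd : d = -a := by linear_combination htr
  subst hd
  let M : Submodule ℂ L := N ⊔ Submodule.span ℂ {y}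
  have hM : ∀ z, z ∈ M ↔ ∃ n ∈ N, ∃ r : ℂ, z = n + r • y := by
    intro z
    rw [Submodule.mem_sup]
    constructor
    · rintro ⟨n, hn, w, hw, rfl⟩
      obtain ⟨r, rfl⟩ := Submodule.mem_span_singleton.1 hw
      exact ⟨n, hn, r, rfl⟩
    · rintro ⟨n, hn, r, rfl⟩
      exact ⟨n, hn, _, Submodule.smul_mem _ _ (Submodule.mem_span_singleton_self y), rfl⟩
  have hideal : IsIdealIn br ⊤ M := by
    refine ⟨le_top, ?_⟩
    have key : ∀ x ∈ M, ∀ z : L, br x z ∈ M := by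
      intro x hx z
      obtain ⟨n, hn, r, rfl⟩ := (hM x).1 hx
      obtain ⟨r', n', hn', e⟩ := hid z
      refine (hM _).2 ⟨br n z + r • n', ?_, r * r', ?_⟩
      · exact N.add_mem (hN.1.2 n hn z trivial).1 (N.smul_mem _ hn')
      · simp only [map_add, map_smul, LinearMap.add_apply, LinearMap.smul_apply, e]; module
    intro x hx z _
    refine ⟨key x hx z, ?_⟩
    rw [H.anti]
    exact M.neg_mem (key x hx z)
  have hM' : ∀ z ∈ M, ∃ p q r w : ℂ, z = p • e2 + q • e3 + r • e1 + w • y := by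
    intro z hz
    obtain ⟨n, hn, w, rfl⟩ := (hM z).1 hz
    obtain ⟨p, q, r, rfl⟩ := (hmem n).1 hn
    exact ⟨p, q, r, w, rfl⟩
  have hy2 : br y e2 = - (a • e2 + b • e3 + s • e1) := by rw [H.anti, h2]
  have hy3 : br y e3 = - (c • e2 + (-a) • e3 + t • e1) := by rw [H.anti, h3]
  have hy1 : br y e1 = 0 := by rw [H.anti, hone, neg_zero]
  have hnil : IsNilpotentSub br M := by
    have l1 : lcs br M 1 ≤ Submodule.span ℂ {a • e2 + b • e3, c • e2 + (-a) • e3, e1} := by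
      change Submodule.span ℂ _ ≤ _
      rw [Submodule.span_le]
      rintro z ⟨x, hx, x', hx', rfl⟩
      obtain ⟨p, q, r, w, rfl⟩ := hM' x hx
      obtain ⟨p', q', r', w', rfl⟩ := hM' x' hx'
      rw [SetLike.mem_coe, Submodule.mem_span_triple]
      refine ⟨p * w' - w * p', q * w' - w * q', p * q' - q * p' + (p * w' - w * p') * s
        + (q * w' - w * q') * t, ?_⟩
      simp only [map_add, map_smul, LinearMap.add_apply, LinearMap.smul_apply, H.h23, H.h13,
        H.h12, H.h32, H.h21, H.h31, anti_self19 H.anti, h2, h3, hone, hy2, hy3, hy1]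
      module
    have l2 : lcs br M 2 ≤ Submodule.span ℂ {e1} := by
      change Submodule.span ℂ _ ≤ _
      rw [Submodule.span_le]
      rintro z ⟨x, hx, x', hx', rfl⟩
      obtain ⟨p, q, r, rfl⟩ := Submodule.mem_span_triple.1 (l1 hx)
      obtain ⟨p', q', r', w', rfl⟩ := hM' x' hx'
      rw [SetLike.mem_coe, Submodule.mem_span_singleton]
      have hbc : b * c = - a * a := by linear_combination -hdet
      refine ⟨(p * a + q * c) * q' - (p * b - q * a) * p' + w' * ((p * a + q * c) * s
        + (p * b - q * a) * t), ?_⟩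
      simp only [map_add, map_smul, LinearMap.add_apply, LinearMap.smul_apply, H.h23, H.h13,
        H.h12, H.h32, H.h21, H.h31, anti_self19 H.anti, h2, h3, hone, hy2, hy3, hy1]
      linear_combination (norm := module) (-(w' * p) * hbc) • e2 + (-(w' * q) * hbc) • e3
    refine ⟨3, ?_⟩
    rw [eq_bot_iff]
    change Submodule.span ℂ _ ≤ _
    rw [Submodule.span_le]
    rintro z ⟨x, hx, x', hx', rfl⟩
    obtain ⟨p, rfl⟩ := Submodule.mem_span_singleton.1 (l2 hx)
    obtain ⟨p', q', r', w', rfl⟩ := hM' x' hx'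
    simp [H.h13, H.h12, anti_self19 H.anti, hone]
  exact hN.2.2 M hideal hnil ((hM y).2 ⟨0, N.zero_mem, 1, by simp⟩)

theorem indep19 {br : Bil L} (v : Fin 5 → L)
    (ht : ∀ i j : Fin 5, br (v i) (v j) = table19 v i j) (h0 : v 0 ≠ 0) :
    LinearIndependent ℂ v := by
  rw [Fintype.linearIndependent_iff]
  intro g hg
  simp only [Fin.sum_univ_five] at hg
  have k1 := congrArg (fun z => br (br (v 1) z) (v 2)) hg
  have k2 := congrArg (fun z => br (br (v 2) z) (v 1)) hg
  simp [ht, table19, h0] at k1 k2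
  have k3 := congrArg (fun z => br (v 1) z) hg
  have k4 := congrArg (fun z => br (v 2) z) hg
  simp [ht, table19, h0, k1, k2] at k3 k4
  simp [k1, k2, k3, k4, h0] at hg
  intro i
  fin_cases i <;> simp [*]

theorem final19 {br : Bil L} {e f g x y : L} (H : Heis19 br e f g) {s t s' t' p q r : ℂ}
    (hfx : br f x = f + s • e) (hgx : br g x = t • e)
    (hfy : br f y = s' • e) (hgy : br g y = g + t' • e)
    (hxy : br x y = q • f + r • g + p • e) :
    ∃ v : Fin 5 → L, v 0 ≠ 0 ∧ ∀ i j : Fin 5, br (v i) (v j) = table19 v i j := by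
  have hex : br e x = e := by
    have := H.one (y := x) (a := 1) (b := 0) (c := 0) (d := 0) ⟨s, t, by simp [hfx], by simp [hgx]⟩
    simpa using this
  have hey : br e y = e := by
    have := H.one (y := y) (a := 0) (b := 0) (c := 0) (d := 1)
      ⟨s', t', by simp [hfy], by simp [hgy]⟩
    simpa using this
  -- adjust `x` and `y` by inner derivations
  obtain ⟨x', hx'⟩ : ∃ x', x' = x + t • f - s • g := ⟨_, rfl⟩
  obtain ⟨y', hy'⟩ : ∃ y', y' = y + t' • f - s' • g := ⟨_, rfl⟩
  have hself := anti_self19 H.anti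
  have afx : br f x' = f := by
    subst hx'
    simp only [map_add, map_sub, map_smul, hfx, hself, H.h23]; module
  have agx : br g x' = 0 := by
    subst hx'
    simp only [map_add, map_sub, map_smul, hgx, hself, H.h32]; module
  have aex : br e x' = e := by
    subst hx'
    simp only [map_add, map_sub, map_smul, hex, H.h12, H.h13]; module
  have afy : br f y' = 0 := by
    subst hy'
    simp only [map_add, map_sub, map_smul, hfy, hself, H.h23]; module
  have agy : br g y' = g := by
    subst hy'
    simp only [map_add, map_sub, map_smul, hgy, hself, H.h32]; module
  have aey : br e y' = e := by
    subst hy'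
    simp only [map_add, map_sub, map_smul, hey, H.h12, H.h13]; module
  obtain ⟨q', r', p', axy⟩ : ∃ q' r' p' : ℂ, br x' y' = q' • f + r' • g + p' • e := by
    have hxf : br x f = - (f + s • e) := by rw [H.anti, hfx]
    have hxg : br x g = - (t • e) := by rw [H.anti, hgx]
    refine ⟨q - t', r - s, p - t' * s + s' * t + t * s' - t * s' - s * t' + s * t', ?_⟩
    subst hx' hy'
    simp only [map_add, map_sub, map_smul, LinearMap.add_apply, LinearMap.sub_apply,
      LinearMap.smul_apply, hfy, hgy, hself, H.h32, H.h23, hxf, hxg, hxy]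
    module
  have l1 := H.leib f x' y'
  have l2 := H.leib g x' y'
  rw [axy] at l1 l2
  simp [afx, agx, afy, agy, hself, H.h23, H.h32, H.h21, H.h31, H.ne] at l1 l2
  replace l1 : r' = 0 := by simpa [H.ne] using l1.symm
  subst l1 l2
  simp only [zero_smul, zero_add] at axy
  obtain ⟨z, hz⟩ : ∃ z, z = x' - p' • e := ⟨_, rfl⟩
  have bfz : br f z = f := by subst hz; simp [afx, H.h21]
  have bgz : br g z = 0 := by subst hz; simp [agx, H.h31]
  have bez : br e z = e := by subst hz; simp [aex, hself]
  have bzy : br z y' = 0 := by subst hz; simp [axy, aey]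
  have bzf : br z f = -f := by rw [H.anti, bfz]
  have bzg : br z g = 0 := by rw [H.anti, bgz, neg_zero]
  have bze : br z e = -e := by rw [H.anti, bez]
  have byz : br y' z = 0 := by rw [H.anti, bzy, neg_zero]
  have byf : br y' f = 0 := by rw [H.anti, afy, neg_zero]
  have byg : br y' g = -g := by rw [H.anti, agy]
  have bye : br y' e = -e := by rw [H.anti, aey]
  refine ⟨![e, f, g, z, y'], H.ne, ?_⟩
  intro i j
  fin_cases i <;> fin_cases j <;>
    simp [table19, hself, H.h12, H.h13, H.h21, H.h31, H.h23, H.h32, bfz, bgz, bez, bzy, bzf, bzg,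
      bze, byz, byf, byg, bye, afy, agy, aey]

theorem scal19 {a b c d a' b' c' d' : ℂ} (h1 : b * c' = b' * c)
    (h2 : (a - d) * b' = (a' - d') * b) (h3 : (a - d) * c' = (a' - d') * c) :
    ∃ p q : ℂ, (p ≠ 0 ∨ q ≠ 0) ∧ p * b + q * b' = 0 ∧ p * c + q * c' = 0 ∧
      p * a + q * a' = p * d + q * d' := by
  by_cases hb : b = 0
  · by_cases hc : c = 0
    · by_cases ha : a - d = 0
      · exact ⟨1, 0, by simp, by simp [hb], by simp [hc], by linear_combination ha⟩
      · exact ⟨a' - d', -(a - d), Or.inr (neg_ne_zero.2 ha), by linear_combination -h2,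
          by linear_combination -h3, by ring⟩
    · exact ⟨c', -c, Or.inr (neg_ne_zero.2 hc), by linear_combination h1, by ring,
        by linear_combination h3⟩
  · exact ⟨b', -b, Or.inr (neg_ne_zero.2 hb), by ring, by linear_combination -h1,
      by linear_combination h2⟩

theorem proj19 {a b c d : ℂ} (htr : a + d = 1) (hdet : a * d - b * c = 0) :
    ∃ p q r s : ℂ, p * s - q * r ≠ 0 ∧ p * a + q * c = p ∧ p * b + q * d = q ∧
      r * a + s * c = 0 ∧ r * b + s * d = 0 := by
  by_cases ha : a = 0
  · have hd : d = 1 := by rw [ha] at htr; simpa using htr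
    subst ha hd
    refine ⟨c, 1, 1, -b, ?_, ?_, ?_, ?_, ?_⟩
    · intro h
      have : (1 : ℂ) = 0 := by linear_combination -h + hdet
      simp at this
    all_goals first | ring1 | linear_combination hdet | linear_combination -hdet
  · refine ⟨a, b, -c, a, ?_, ?_, ?_, ?_, ?_⟩
    · intro h
      exact ha (by linear_combination h + hdet - a * htr)
    all_goals first | ring1 | linear_combination a * htr - hdet | linear_combination b * htr |
      linear_combination hdet

theorem Heis19.main {br : Bil L} {e1 e2 e3 : L} (H : Heis19 br e1 e2 e3) {N : Submodule ℂ L}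
    (hN : IsNilradical br N) (hmem : ∀ z, z ∈ N ↔ ∃ b c a : ℂ, z = b • e2 + c • e3 + a • e1)
    {y1 y2 : L} (hspan : ∀ z, ∃ n ∈ N, ∃ p q : ℂ, z = n + p • y1 + q • y2)
    (hind : ∀ p q : ℂ, p • y1 + q • y2 ∈ N → p = 0 ∧ q = 0) :
    ∃ v : Fin 5 → L, v 0 ≠ 0 ∧ ∀ i j : Fin 5, br (v i) (v j) = table19 v i j := by
  have hself := anti_self19 H.anti
  have m2 : e2 ∈ N := (hmem _).2 ⟨1, 0, 0, by simp⟩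
  have m3 : e3 ∈ N := (hmem _).2 ⟨0, 1, 0, by simp⟩
  have rep : ∀ y, ∃ a b c d, Rep19 br e1 e2 e3 y a b c d := by
    intro y
    obtain ⟨a, b, s, h⟩ := (hmem _).1 (hN.1.2 e2 m2 y trivial).1
    obtain ⟨c, d, t, h'⟩ := (hmem _).1 (hN.1.2 e3 m3 y trivial).1
    exact ⟨a, b, c, d, s, t, h, h'⟩
  have repN : ∀ n ∈ N, Rep19 br e1 e2 e3 n 0 0 0 0 := by
    intro n hn
    obtain ⟨q, r, p, rfl⟩ := (hmem _).1 hn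
    refine ⟨r, -q, ?_, ?_⟩ <;> simp [hself, H.h23, H.h32, H.h21, H.h31]
  obtain ⟨a, b, c, d, R1⟩ := rep y1
  obtain ⟨a', b', c', d', R2⟩ := rep y2
  obtain ⟨n, hn, p, q, hw⟩ := hspan (br y1 y2)
  -- commutator relation
  have Rw : Rep19 br e1 e2 e3 (br y1 y2) (p * a + q * a') (p * b + q * b') (p * c + q * c')
      (p * d + q * d') := by
    have := (repN n hn).lin (R1.lin R2 p q) 1 1
    simp only [one_smul, one_mul, zero_add, mul_zero] at this
    rw [hw, add_assoc]; exact this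
  have o1 := H.one R1
  have o2 := H.one R2
  have comm : (a * a' + b * c' = a' * a + b' * c + (p * a + q * a') ∧
      a * b' + b * d' = a' * b + b' * d + (p * b + q * b')) ∧
      (c * a' + d * c' = c' * a + d' * c + (p * c + q * c') ∧
      c * b' + d * d' = c' * b + d' * d + (p * d + q * d')) := by
    obtain ⟨s, t, h2, h3⟩ := R1
    obtain ⟨s', t', h2', h3'⟩ := R2
    obtain ⟨s'', t'', h2'', h3''⟩ := Rw
    have l2 := H.leib e2 y1 y2
    have l3 := H.leib e3 y1 y2
    rw [h2, h2', h2''] at l2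
    rw [h3, h3', h3''] at l3
    simp only [map_add, map_smul, LinearMap.add_apply, LinearMap.smul_apply, h2, h3, h2', h3',
      o1, o2] at l2 l3
    constructor
    · have k := H.coef (b := a * a' + b * c' - (a' * a + b' * c + (p * a + q * a')))
        (c := a * b' + b * d' - (a' * b + b' * d + (p * b + q * b')))
        (a := a * s' + b * t' + s * (a' + d') - (a' * s + b' * t + s' * (a + d) + s''))
        (by linear_combination (norm := module) l2)
      exact ⟨sub_eq_zero.1 k.1, sub_eq_zero.1 k.2.1⟩
    · have k := H.coef (b := c * a' + d * c' - (c' * a + d' * c + (p * c + q * c')))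
        (c := c * b' + d * d' - (c' * b + d' * d + (p * d + q * d')))
        (a := c * s' + d * t' + t * (a' + d') - (c' * s + d' * t + t' * (a + d) + t''))
        (by linear_combination (norm := module) l3)
      exact ⟨sub_eq_zero.1 k.1, sub_eq_zero.1 k.2.1⟩
  obtain ⟨⟨c1, c2⟩, c3, c4⟩ := comm
  have nbr : ∀ n ∈ N, ∀ z, br n z ∈ N := fun n hn z => (hN.1.2 n hn z trivial).1
  have nbr' : ∀ n ∈ N, ∀ z, br z n ∈ N := fun n hn z => (hN.1.2 n hn z trivial).2
  -- the bracket of y1, y2 lies in N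
  have hyy : br y1 y2 ∈ N := by
    have tr0 : (p * a + q * a') + (p * d + q * d') = 0 := by linear_combination -c1 - c4
    refine H.nil hN hmem Rw tr0 ?_ ?_
    · have sq : (p * a + q * a') ^ 2 + 2 * (p * b + q * b') * (p * c + q * c')
          + (p * d + q * d') ^ 2 = 0 := by
        linear_combination -(p * a + q * a') * c1 - (p * c + q * c') * c2
          - (p * b + q * b') * c3 - (p * d + q * d') * c4
      linear_combination ((p * a + q * a') + (p * d + q * d')) / 2 * tr0 - sq / 2
    · intro z
      obtain ⟨m, hm, u, w, rfl⟩ := hspan z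
      have hy21 : br y2 y1 = -br y1 y2 := H.anti _ _
      refine ⟨p * w - q * u, br (br y1 y2) m + (u • br n y1 + w • br n y2), ?_, ?_⟩
      · exact N.add_mem (nbr' m hm _) (N.add_mem (N.smul_mem _ (nbr n hn _))
          (N.smul_mem _ (nbr n hn _)))
      · have e1' : br (br y1 y2) y1 = br n y1 - q • br y1 y2 := by
          conv_lhs => rw [hw]
          simp only [map_add, map_smul, LinearMap.add_apply, LinearMap.smul_apply, hself, hy21]
          module
        have e2' : br (br y1 y2) y2 = br n y2 + p • br y1 y2 := by
          conv_lhs => rw [hw]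
          simp only [map_add, map_smul, LinearMap.add_apply, LinearMap.smul_apply, hself]
          module
        rw [map_add, map_add, map_smul, map_smul, e1', e2']
        module
  have hLL : ∀ x y, br x y ∈ N := by
    intro x y
    obtain ⟨m, hm, u, w, rfl⟩ := hspan x
    obtain ⟨m', hm', u', w', rfl⟩ := hspan y
    have hy21 : br y2 y1 = -br y1 y2 := H.anti _ _
    have : br (m + u • y1 + w • y2) (m' + u' • y1 + w' • y2) =
      br m (m' + u' • y1 + w' • y2) + br (u • y1 + w • y2) m' + (u * w' - w * u') • br y1 y2 := by
      simp only [map_add, map_smul, LinearMap.add_apply, LinearMap.smul_apply, hself, hy21]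
      module
    rw [this]
    exact N.add_mem (N.add_mem (nbr _ hm _) (nbr' _ hm' _)) (N.smul_mem _ hyy)
  have nil : ∀ {y : L} {a b c d : ℂ}, Rep19 br e1 e2 e3 y a b c d → a + d = 0 →
      a * d - b * c = 0 → y ∈ N := by
    intro y a b c d h ht hd
    exact H.nil hN hmem h ht hd (fun z => ⟨0, br y z, hLL y z, by simp⟩)
  have hpq : p = 0 ∧ q = 0 := by
    apply hind
    have : p • y1 + q • y2 = br y1 y2 - n := by rw [hw]; abel
    rw [this]
    exact N.sub_mem hyy hn
  obtain ⟨rfl, rfl⟩ := hpq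
  obtain ⟨α, β, hαβ, s1, s2, s3⟩ := scal19 (a := a) (b := b) (c := c) (d := d) (a' := a')
    (b' := b') (c' := c') (d' := d') (by linear_combination c1) (by linear_combination c2)
    (by linear_combination -c3)
  have R0 := R1.lin R2 α β
  rw [s1, s2, ← s3] at R0
  obtain ⟨μ, hμ⟩ : ∃ μ, μ = α * a + β * a' := ⟨_, rfl⟩
  rw [← hμ] at R0
  have hμ0 : μ ≠ 0 := by
    intro h0
    rw [h0] at R0
    obtain ⟨h1, h2⟩ := hind _ _ (nil R0 (by ring) (by ring))
    simp [h1, h2] at hαβ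
  -- an element outside the line of y0
  obtain ⟨y', hy'⟩ : ∃ y', ∀ t : ℂ, y' + t • (α • y1 + β • y2) ∉ N := by
    by_cases hα : α = 0
    · refine ⟨y1, fun t ht => ?_⟩
      have : y1 + t • (α • y1 + β • y2) = (1 + t * α) • y1 + (t * β) • y2 := by module
      rw [this] at ht
      have := (hind _ _ ht).1
      simp [hα] at this
    · refine ⟨y2, fun t ht => ?_⟩
      have : y2 + t • (α • y1 + β • y2) = (t * α) • y1 + (1 + t * β) • y2 := by module
      rw [this] at ht
      have h := hind _ _ ht
      have ht0 : t = 0 := by simpa [hα] using h.1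
      simp [ht0] at h
  obtain ⟨A, B, C, D, R'⟩ := rep y'
  obtain ⟨y0, hy0⟩ : ∃ y0, y0 = μ⁻¹ • (α • y1 + β • y2) := ⟨_, rfl⟩
  have R0' : Rep19 br e1 e2 e3 y0 1 0 0 1 := by
    have := R0.lin R0 μ⁻¹ 0
    simpa [hμ0, ← hy0] using this
  have hy'0 : ∀ t : ℂ, (1 : ℂ) • y' + t • y0 ∉ N := by
    intro t
    rw [hy0, smul_smul, one_smul]
    exact hy' _
  obtain ⟨S, hS⟩ := IsAlgClosed.exists_pow_nat_eq ((A + D) ^ 2 - 4 * (A * D - B * C))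
    (n := 2) (by norm_num)
  have hS0 : S ≠ 0 := by
    intro h0
    subst h0
    refine hy'0 (-(A + D) / 2) (nil (R'.lin R0' 1 (-(A + D) / 2)) (by ring) ?_)
    linear_combination hS / 4
  have RX := R'.lin R0' S⁻¹ (-(S⁻¹ * ((A + D - S) / 2)))
  obtain ⟨x, hx⟩ : ∃ x, x = S⁻¹ • y' + (-(S⁻¹ * ((A + D - S) / 2))) • y0 := ⟨_, rfl⟩
  rw [← hx] at RX
  obtain ⟨P, Q, R, T, RX', htr, hdet⟩ : ∃ P Q R T, Rep19 br e1 e2 e3 x P Q R T ∧ P + T = 1 ∧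
      P * T - Q * R = 0 := by
    refine ⟨_, _, _, _, RX, ?_, ?_⟩
    · field_simp; ring
    · field_simp
      linear_combination hS
  have RY := R0'.lin RX' 1 (-1)
  obtain ⟨y, hy⟩ : ∃ y, y = (1 : ℂ) • y0 + (-1 : ℂ) • x := ⟨_, rfl⟩
  rw [← hy] at RY
  obtain ⟨f1, f2, g1, g2, hΔ, k1, k2, k3, k4⟩ := proj19 htr hdet
  obtain ⟨δ, hδ⟩ : ∃ δ, δ = f1 * g2 - f2 * g1 := ⟨_, rfl⟩
  rw [← hδ] at hΔ
  have HF : Heis19 br (δ • e1) (f1 • e2 + f2 • e3) (g1 • e2 + g2 • e3) := by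
    refine ⟨H.leib, H.anti, ?_, ?_, ?_, ?_⟩
    · simp [hself, H.h23, H.h32, hδ]; module
    · simp [H.h12, H.h13]
    · simp [H.h12, H.h13]
    · simp [hΔ, H.ne]
  obtain ⟨i, j, hx2, hx3⟩ := RX'
  obtain ⟨k, l, hY2, hY3⟩ := RY
  obtain ⟨U, V, W, hxy⟩ := (hmem _).1 (hLL x y)
  refine final19 HF (x := x) (y := y) (s := δ⁻¹ * (f1 * i + f2 * j)) (t := δ⁻¹ * (g1 * i + g2 * j))
    (s' := δ⁻¹ * (f1 * k + f2 * l)) (t' := δ⁻¹ * (g1 * k + g2 * l))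
    (q := δ⁻¹ * (U * g2 - V * g1)) (r := δ⁻¹ * (V * f1 - U * f2)) (p := δ⁻¹ * W) ?_ ?_ ?_ ?_ ?_
  · have : (δ⁻¹ * (f1 * i + f2 * j)) • δ • e1 = (f1 * i + f2 * j) • e1 := by
      rw [smul_smul]; congr 1; field_simp
    rw [this]
    simp only [map_add, map_smul, LinearMap.add_apply, LinearMap.smul_apply, hx2, hx3]
    linear_combination (norm := module) k1 • e2 + k2 • e3
  · have : (δ⁻¹ * (g1 * i + g2 * j)) • δ • e1 = (g1 * i + g2 * j) • e1 := by
      rw [smul_smul]; congr 1; field_simp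
    rw [this]
    simp only [map_add, map_smul, LinearMap.add_apply, LinearMap.smul_apply, hx2, hx3]
    linear_combination (norm := module) k3 • e2 + k4 • e3
  · have : (δ⁻¹ * (f1 * k + f2 * l)) • δ • e1 = (f1 * k + f2 * l) • e1 := by
      rw [smul_smul]; congr 1; field_simp
    rw [this]
    simp only [map_add, map_smul, LinearMap.add_apply, LinearMap.smul_apply, hY2, hY3]
    linear_combination (norm := module) (-k1) • e2 + (-k2) • e3
  · have : (δ⁻¹ * (g1 * k + g2 * l)) • δ • e1 = (g1 * k + g2 * l) • e1 := by
      rw [smul_smul]; congr 1; field_simp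
    rw [this]
    simp only [map_add, map_smul, LinearMap.add_apply, LinearMap.smul_apply, hY2, hY3]
    linear_combination (norm := module) (-k3) • e2 + (-k4) • e3
  · rw [hxy]
    have hi : δ⁻¹ * (f1 * g2 - f2 * g1) = 1 := by rw [← hδ]; field_simp
    have hj : δ⁻¹ * δ = 1 := by field_simp
    linear_combination (norm := module) (-U * hi) • e2 + (-V * hi) • e3 + (-W * hj) • e1

/-- The model bracket. -/
noncomputable def model19 : Bil (Fin 5 → ℂ) :=
  LinearMap.mk₂ ℂ (fun x y => ![x 1 * y 2 - x 2 * y 1 + x 0 * (y 3 + y 4) - (x 3 + x 4) * y 0,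
    x 1 * y 3 - x 3 * y 1, x 2 * y 4 - x 4 * y 2, 0, 0])
    (by intro x x' y; ext i; fin_cases i <;> simp <;> ring)
    (by intro c x y; ext i; fin_cases i <;> simp <;> ring)
    (by intro x x' y; ext i; fin_cases i <;> simp <;> ring)
    (by intro c x y; ext i; fin_cases i <;> simp <;> ring)

theorem model19_apply (x y : Fin 5 → ℂ) : model19 x y =
    ![x 1 * y 2 - x 2 * y 1 + x 0 * (y 3 + y 4) - (x 3 + x 4) * y 0,
    x 1 * y 3 - x 3 * y 1, x 2 * y 4 - x 4 * y 2, 0, 0] := rfl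

/-- The nilradical of the model. -/
def nr19 : Submodule ℂ (Fin 5 → ℂ) where
  carrier := {x | x 3 = 0 ∧ x 4 = 0}
  add_mem' := by rintro x y ⟨h, h'⟩ ⟨k, k'⟩; simp [*]
  zero_mem' := by simp
  smul_mem' := by rintro c x ⟨h, h'⟩; simp [*]

/-- The centre of the nilradical of the model. -/
def cn19 : Submodule ℂ (Fin 5 → ℂ) where
  carrier := {x | x 1 = 0 ∧ x 2 = 0 ∧ x 3 = 0 ∧ x 4 = 0}
  add_mem' := by rintro x y ⟨h, h', h'', h3⟩ ⟨k, k', k'', k3⟩; simp [*]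
  zero_mem' := by simp
  smul_mem' := by rintro c x ⟨h, h', h'', h3⟩; simp [*]

theorem bspan_le19 {br : Bil L} {S T U : Submodule ℂ L}
    (h : ∀ x ∈ S, ∀ y ∈ T, br x y ∈ U) : bspan br S T ≤ U := by
  unfold bspan
  rw [Submodule.span_le]
  rintro z ⟨x, hx, y, hy, rfl⟩
  exact h x hx y hy

theorem nn19 : ∀ x ∈ nr19, ∀ y ∈ nr19, model19 x y ∈ cn19 := by
  rintro x ⟨h, h'⟩ y ⟨k, k'⟩
  refine ⟨?_, ?_, ?_, ?_⟩ <;> simp [model19_apply, *]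

theorem cn19_nr : ∀ x ∈ cn19, ∀ y ∈ nr19, model19 x y = 0 := by
  rintro x ⟨h1, h2, h3, h4⟩ y ⟨k, k'⟩
  ext i
  fin_cases i <;> simp [model19_apply, *]

theorem solv19 : IsSolvableSub model19 ⊤ := by
  have d1 : derS model19 ⊤ 1 ≤ nr19 := by
    apply bspan_le19
    intro x _ y _
    exact ⟨by simp [model19_apply], by simp [model19_apply]⟩
  have d2 : derS model19 ⊤ 2 ≤ cn19 :=
    bspan_le19 (fun x hx y hy => nn19 x (d1 hx) y (d1 hy))
  have hle : cn19 ≤ nr19 := fun x hx => ⟨hx.2.2.1, hx.2.2.2⟩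
  refine ⟨3, eq_bot_iff.2 (bspan_le19 (fun x hx y hy => ?_))⟩
  rw [cn19_nr x (d2 hx) y (hle (d2 hy))]
  exact Submodule.zero_mem _

theorem leib19 : IsLeibniz model19 := by
  intro x y z
  ext i
  fin_cases i <;> simp [model19_apply] <;> ring

theorem antis19 (x y : Fin 5 → ℂ) : model19 x y = - model19 y x := by
  ext i
  fin_cases i <;> simp [model19_apply] <;> ring

theorem nilrad19 : IsNilradical model19 nr19 := by
  refine ⟨⟨le_top, ?_⟩, ?_, ?_⟩
  · intro x _ y _
    exact ⟨⟨by simp [model19_apply], by simp [model19_apply]⟩,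
      ⟨by simp [model19_apply], by simp [model19_apply]⟩⟩
  · have d1 : lcs model19 nr19 1 ≤ cn19 := bspan_le19 (fun x hx y hy => nn19 x hx y hy)
    refine ⟨2, eq_bot_iff.2 (bspan_le19 (fun x hx y hy => ?_))⟩
    rw [cn19_nr x (d1 hx) y hy]
    exact Submodule.zero_mem _
  · rintro I hI ⟨n, hn⟩ x hx
    constructor
    · by_contra h
      have key : ∀ k, ∃ w ∈ lcs model19 I k, w 1 ≠ 0 ∧ w 3 = 0 := by
        intro k
        induction k with
        | zero =>
          refine ⟨_, (hI.2 x hx (Pi.single 1 1) trivial).2, ?_, ?_⟩ <;>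
            simp [model19_apply, h]
        | succ k ih =>
          obtain ⟨w, hw, h1, h3⟩ := ih
          refine ⟨model19 w x, Submodule.subset_span ⟨w, hw, x, hx, rfl⟩, ?_, ?_⟩ <;>
            simp [model19_apply, h, h1, h3]
      obtain ⟨w, hw, h1, _⟩ := key n
      rw [hn, Submodule.mem_bot] at hw
      simp [hw] at h1
    · by_contra h
      have key : ∀ k, ∃ w ∈ lcs model19 I k, w 2 ≠ 0 ∧ w 4 = 0 := by
        intro k
        induction k with
        | zero =>
          refine ⟨_, (hI.2 x hx (Pi.single 2 1) trivial).2, ?_, ?_⟩ <;>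
            simp [model19_apply, h]
        | succ k ih =>
          obtain ⟨w, hw, h1, h3⟩ := ih
          refine ⟨model19 w x, Submodule.subset_span ⟨w, hw, x, hx, rfl⟩, ?_, ?_⟩ <;>
            simp [model19_apply, h, h1, h3]
      obtain ⟨w, hw, h1, _⟩ := key n
      rw [hn, Submodule.mem_bot] at hw
      simp [hw] at h1

theorem dec19 (x : Fin 3 → ℂ) :
    x = x 0 • Pi.single 0 1 + x 1 • Pi.single 1 1 + x 2 • Pi.single 2 1 := by
  ext i
  fin_cases i <;> simp

theorem iso19 (brH : Bil (Fin 3 → ℂ))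
    (hbrH : ∀ i j : Fin 3, brH (Pi.single i 1) (Pi.single j 1) =
      if i = 1 ∧ j = 2 then Pi.single (0 : Fin 3) 1
      else if i = 2 ∧ j = 1 then -Pi.single (0 : Fin 3) 1
      else 0) : SubAlgIso brH ⊤ model19 nr19 := by
  have hH : ∀ x y : Fin 3 → ℂ, brH x y = (x 1 * y 2 - x 2 * y 1) • Pi.single 0 1 := by
    intro x y
    conv_lhs => rw [dec19 x, dec19 y]
    simp only [map_add, map_smul, LinearMap.add_apply, LinearMap.smul_apply, hbrH]
    simp
    module
  let ψ : (Fin 3 → ℂ) →ₗ[ℂ] (Fin 5 → ℂ) :=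
    { toFun := fun x => ![x 0, x 1, x 2, 0, 0]
      map_add' := by intro x y; ext i; fin_cases i <;> simp
      map_smul' := by intro c x; ext i; fin_cases i <;> simp }
  have hψ : ∀ x, ψ x = ![x 0, x 1, x 2, 0, 0] := fun _ => rfl
  refine ⟨ψ.comp (Submodule.subtype ⊤), ?_, ?_, ?_⟩
  · rintro ⟨x, _⟩ ⟨y, _⟩ h
    simp only [LinearMap.comp_apply, Submodule.subtype_apply, hψ] at h
    have h0 := congrFun h 0
    have h1 := congrFun h 1
    have h2 := congrFun h 2
    simp at h0 h1 h2
    ext i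
    fin_cases i <;> simp [*]
  · ext z
    constructor
    · rintro ⟨x, rfl⟩
      exact ⟨rfl, rfl⟩
    · rintro ⟨h, h'⟩
      refine ⟨⟨![z 0, z 1, z 2], trivial⟩, ?_⟩
      simp only [LinearMap.comp_apply, Submodule.subtype_apply, hψ]
      ext i
      fin_cases i <;> simp [*]
  · rintro ⟨x, _⟩ ⟨y, _⟩ ⟨z, _⟩ h
    simp only [LinearMap.comp_apply, Submodule.subtype_apply, hψ, model19_apply] at h ⊢
    rw [hH] at h
    subst h
    ext i
    fin_cases i <;> simp

/-- Remark 3.14. Up to isomorphism there is exactly one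
`5`-dimensional complex solvable Lie algebra whose nilradical is the `3`-dimensional
Heisenberg algebra `H₁` (`[e₂,e₃] = -[e₃,e₂] = e₁`): such an algebra exists, and every
such algebra admits a basis realizing the table (hence any two of them are isomorphic).
A Lie algebra is formalized as a Leibniz algebra with antisymmetric bracket. -/
theorem stmt19
    (brH : Bil (Fin 3 → ℂ))
    (hbrH : ∀ i j : Fin 3, brH (Pi.single i 1) (Pi.single j 1) =
      if i = 1 ∧ j = 2 then Pi.single (0 : Fin 3) 1
      else if i = 2 ∧ j = 1 then -Pi.single (0 : Fin 3) 1
      else 0) :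
    (∃ br5 : Bil (Fin 5 → ℂ),
      (∀ i j : Fin 5, br5 (Pi.single i 1) (Pi.single j 1) =
        table19 (fun t => Pi.single t 1) i j) ∧
      IsLeibniz br5 ∧ (∀ x y : Fin 5 → ℂ, br5 x y = - br5 y x) ∧
      IsSolvableSub br5 ⊤ ∧
      ∃ M, IsNilradical br5 M ∧ SubAlgIso brH ⊤ br5 M) ∧
    (∀ (L : Type u) [AddCommGroup L] [Module ℂ L] [FiniteDimensional ℂ L]
      (br : Bil L), IsLeibniz br → (∀ x y : L, br x y = - br y x) →
      IsSolvableSub br (⊤ : Submodule ℂ L) → finrank ℂ L = 5 →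
      (∃ N, IsNilradical br N ∧ SubAlgIso brH ⊤ br N) →
      ∃ v : Fin 5 → L,
        LinearIndependent ℂ v ∧ Submodule.span ℂ (Set.range v) = ⊤ ∧
        ∀ i j : Fin 5, br (v i) (v j) = table19 v i j) := by
  refine ⟨⟨model19, ?_, leib19, antis19, solv19, nr19, nilrad19, iso19 brH hbrH⟩, ?_⟩
  · intro i j
    ext k
    fin_cases i <;> fin_cases j <;> fin_cases k <;> simp [model19_apply, table19, Pi.single_apply]
  · intro L _ _ _ br hL hA _ hdim ⟨N, hN, φ, hinj, hrange, hφ⟩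
    let ι : (Fin 3 → ℂ) →ₗ[ℂ] L := φ.comp (LinearMap.codRestrict ⊤ LinearMap.id (fun _ => trivial))
    have hι : ∀ x, ι x = φ ⟨x, trivial⟩ := fun _ => rfl
    have ιinj : Function.Injective ι := by
      intro x y h
      rw [hι, hι] at h
      exact congrArg Subtype.val (hinj h)
    have ιbr : ∀ x y, br (ι x) (ι y) = ι (brH x y) := fun x y =>
      (hφ ⟨x, trivial⟩ ⟨y, trivial⟩ ⟨brH x y, trivial⟩ rfl).symm
    have ιrange : LinearMap.range ι = N := by
      ext z
      rw [← SetLike.mem_coe (p := N), ← hrange]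
      constructor
      · rintro ⟨x, rfl⟩
        exact ⟨⟨x, trivial⟩, rfl⟩
      · rintro ⟨x, rfl⟩
        exact ⟨x.1, rfl⟩
    have H : Heis19 br (ι (Pi.single 0 1)) (ι (Pi.single 1 1)) (ι (Pi.single 2 1)) := by
      refine ⟨hL, hA, ?_, ?_, ?_, ?_⟩
      · rw [ιbr, hbrH]; simp
      · rw [ιbr, hbrH]; simp
      · rw [ιbr, hbrH]; simp
      · intro h
        have := ιinj (h.trans (map_zero ι).symm)
        simp at this
    have hmem : ∀ z, z ∈ N ↔ ∃ b c a : ℂ, z = b • ι (Pi.single 1 1) + c • ι (Pi.single 2 1)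
        + a • ι (Pi.single 0 1) := by
      intro z
      rw [← ιrange]
      constructor
      · rintro ⟨x, rfl⟩
        refine ⟨x 1, x 2, x 0, ?_⟩
        conv_lhs => rw [dec19 x]
        simp only [map_add, map_smul]
        abel
      · rintro ⟨b, c, a, rfl⟩
        exact ⟨b • Pi.single 1 1 + c • Pi.single 2 1 + a • Pi.single 0 1, by simp⟩
    have hd3 : finrank ℂ N = 3 := by
      rw [← ιrange, LinearMap.finrank_range_of_inj ιinj]
      simp
    have hd2 : finrank ℂ (L ⧸ N) = 2 := by
      have := N.finrank_quotient_add_finrank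
      omega
    let B := Module.finBasisOfFinrankEq ℂ (L ⧸ N) hd2
    obtain ⟨y1, hy1⟩ := N.mkQ_surjective (B 0)
    obtain ⟨y2, hy2⟩ := N.mkQ_surjective (B 1)
    obtain ⟨v, hv0, hv⟩ := H.main hN hmem (y1 := y1) (y2 := y2) (by
      intro z
      refine ⟨z - (B.repr (N.mkQ z) 0 • y1 + B.repr (N.mkQ z) 1 • y2), ?_,
        B.repr (N.mkQ z) 0, B.repr (N.mkQ z) 1, by abel⟩
      rw [← Submodule.Quotient.mk_eq_zero N, ← Submodule.mkQ_apply, map_sub, map_add, map_smul,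
        map_smul, hy1, hy2]
      have := B.sum_repr (N.mkQ z)
      rw [Fin.sum_univ_two] at this
      rw [this, sub_self]) (by
      intro p q h
      rw [← Submodule.ker_mkQ N, LinearMap.mem_ker, map_add, map_smul, map_smul, hy1, hy2] at h
      have := Fintype.linearIndependent_iff.1 B.linearIndependent ![p, q]
        (by simpa [Fin.sum_univ_two] using h)
      exact ⟨this 0, this 1⟩)
    have hli := indep19 v hv hv0
    exact ⟨v, hli, hli.span_eq_top_of_card_eq_finrank (by simp [hdim]), hv⟩
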